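/- arXiv:1610.01920 — 14 statements merged into one kernel-verified Lean document; each statement's English description precedes it below -/
import Mathlib

section
/- Let n ≥ 1 and let Y be a finite set of natural numbers whose covering set S(Y) contains every natural number less than 2^n. Then 2^n ≤ C(|Y|, 2) + 1 (binomial coefficient); in particular |Y|² ≥ 2^n. -/
/-- The covering set of a finite set of natural numbers:
all bitwise exclusive-ors of pairs of its elements. -/
def coveringSet (Y : Finset ℕ) : Finset ℕ :=
  Finset.image₂ (fun a b => a ^^^ b) Y Y

/-- The covering set consists of `0` and at most one value for each unordered pair of
distinct elements. -/
theorem card_coveringSet_le (Y : Finset ℕ) :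
    (coveringSet Y).card ≤ Nat.choose Y.card 2 + 1 := by
  let f : Sym2 ℕ → ℕ := Sym2.lift ⟨fun a b => a ^^^ b, Nat.xor_comm⟩
  have hsub : coveringSet Y ⊆ insert 0 ((Y.offDiag.image Sym2.mk.uncurry).image f) := by
    intro x hx
    obtain ⟨a, ha, b, hb, rfl⟩ := Finset.mem_image₂.mp hx
    by_cases hab : a = b
    · simp [hab]
    · exact Finset.mem_insert_of_mem <| Finset.mem_image.mpr
        ⟨s(a, b), Finset.mem_image.mpr
          ⟨(a, b), Finset.mem_offDiag.mpr ⟨ha, hb, hab⟩, rfl⟩, rfl⟩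
  calc (coveringSet Y).card
      ≤ (insert 0 ((Y.offDiag.image Sym2.mk.uncurry).image f)).card := Finset.card_le_card hsub
    _ ≤ ((Y.offDiag.image Sym2.mk.uncurry).image f).card + 1 := Finset.card_insert_le _ _
    _ ≤ (Y.offDiag.image Sym2.mk.uncurry).card + 1 := by
      gcongr
      exact Finset.card_image_le
    _ = Nat.choose Y.card 2 + 1 := by rw [Sym2.card_image_offDiag]

/-- Counting core of Theorem 6: if the covering set of `Y` contains every
natural number below `2^n`, then `2^n ≤ C(|Y|, 2) + 1`, and in particular
`|Y|^2 ≥ 2^n`. -/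
theorem stmt_0 (n : ℕ) (hn : 1 ≤ n) (Y : Finset ℕ)
    (hY : ∀ x, x < 2 ^ n → x ∈ coveringSet Y) :
    2 ^ n ≤ Nat.choose Y.card 2 + 1 ∧ 2 ^ n ≤ Y.card ^ 2 := by
  have hsub : Finset.range (2 ^ n) ⊆ coveringSet Y := fun x hx => hY x (Finset.mem_range.mp hx)
  constructor
  · simpa using (Finset.card_le_card hsub).trans (card_coveringSet_le Y)
  · calc 2 ^ n ≤ (coveringSet Y).card := by simpa using Finset.card_le_card hsub
      _ ≤ Y.card * Y.card := Finset.card_image₂_le _ _ _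
      _ = Y.card ^ 2 := (sq _).symm
end

section
/- For Algorithm 4 and every k ≥ 0, the maximum of MSB(y) over y ∈ Y⁽ᵏ⁾ equals k + 1. -/
/-- The sets `Y⁽ᵏ⁾` of Algorithm 4:
`Y⁽⁰⁾ = {0, 1}`, and `Y⁽ᵏ⁺¹⁾ = Y⁽ᵏ⁾ ∪ {2^(k+1) ⊕ y : y ∈ Y⁽ᵏ⁾, MSB(y) < k+1}`. -/
def Y4 : ℕ → Finset ℕ
  | 0 => {0, 1}
  | k + 1 =>
      Y4 k ∪ ((Y4 k).filter (fun y => Nat.size y < k + 1)).image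
        (fun y => 2 ^ (k + 1) ^^^ y)

theorem zero_mem_Y4 (k : ℕ) : 0 ∈ Y4 k := by
  induction k with
  | zero => simp [Y4]
  | succ k ih => exact Finset.mem_union_left _ ih

theorem two_pow_mem_Y4 (k : ℕ) : 2 ^ k ∈ Y4 k := by
  cases k with
  | zero => simp [Y4]
  | succ k =>
    refine Finset.mem_union_right _ (Finset.mem_image.2 ⟨0, ?_, by simp⟩)
    simp [zero_mem_Y4]

theorem lt_two_pow_of_mem_Y4 {k y : ℕ} (hy : y ∈ Y4 k) : y < 2 ^ (k + 1) := by
  induction k generalizing y with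
  | zero =>
    simp only [Y4, Finset.mem_insert, Finset.mem_singleton] at hy
    omega
  | succ k ih =>
    have hlt : 2 ^ (k + 1) < 2 ^ (k + 1 + 1) := Nat.pow_lt_pow_right one_lt_two (Nat.lt_succ_self _)
    rcases Finset.mem_union.1 hy with hy | hy
    · exact (ih hy).trans hlt
    · obtain ⟨z, hz, rfl⟩ := Finset.mem_image.1 hy
      exact Nat.xor_lt_two_pow hlt ((ih (Finset.mem_filter.1 hz).1).trans hlt)

/-- For Algorithm 4 and every `k ≥ 0`, the maximum of `MSB(y)` over `y ∈ Y⁽ᵏ⁾`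
equals `k + 1`. -/
theorem stmt_1 (k : ℕ) : (Y4 k).sup Nat.size = k + 1 := by
  refine le_antisymm (Finset.sup_le fun y hy => Nat.size_le.2 (lt_two_pow_of_mem_Y4 hy)) ?_
  rw [← Nat.size_pow (n := k)]
  exact Finset.le_sup (two_pow_mem_Y4 k)
end

section
/- For Algorithm 4 and every k ≥ 2, one has Z⁽ᵏ⁾ = {2^k ⊕ y : y ∈ Y⁽ᵏ⁻²⁾}. -/
/-- The sets `Z⁽ᵏ⁾` of Algorithm 4 (for `k ≥ 1`):
`Z⁽ᵏ⁾ = {2^k ⊕ y : y ∈ Y⁽ᵏ⁻¹⁾, MSB(y) < k}`. -/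
def Z4 (k : ℕ) : Finset ℕ :=
  ((Y4 (k - 1)).filter (fun y => Nat.size y < k)).image (fun y => 2 ^ k ^^^ y)

theorem Nat.size_two_pow_xor {k y : ℕ} (hy : Nat.size y ≤ k) :
    Nat.size (2 ^ k ^^^ y) = k + 1 := by
  have hlt : y < 2 ^ k := Nat.size_le.mp hy
  refine le_antisymm (Nat.size_le.mpr ?_) (Nat.lt_size.mpr ?_)
  · exact Nat.xor_lt_two_pow (Nat.pow_lt_pow_right one_lt_two k.lt_succ_self)
      (hlt.trans (Nat.pow_lt_pow_right one_lt_two k.lt_succ_self))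
  · exact Nat.ge_two_pow_of_testBit
      (by simp [Nat.testBit_xor, Nat.testBit_lt_two_pow hlt])

theorem size_le_of_mem_Y4 {k y : ℕ} (hy : y ∈ Y4 k) : Nat.size y ≤ k + 1 := by
  induction k generalizing y with
  | zero =>
    simp only [Y4, Finset.mem_insert, Finset.mem_singleton] at hy
    rcases hy with rfl | rfl <;> simp
  | succ k ih =>
    simp only [Y4, Finset.mem_union, Finset.mem_image, Finset.mem_filter] at hy
    rcases hy with hy | ⟨x, ⟨-, hx⟩, rfl⟩
    · exact (ih hy).trans (Nat.le_succ _)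
    · exact (Nat.size_two_pow_xor hx.le).le

theorem filter_size_lt_Y4_succ (k : ℕ) :
    (Y4 (k + 1)).filter (fun y => Nat.size y < k + 2) = Y4 k := by
  ext y
  simp only [Y4, Finset.mem_filter, Finset.mem_union, Finset.mem_image]
  constructor
  · rintro ⟨hy | ⟨x, ⟨-, hx⟩, rfl⟩, hlt⟩
    · exact hy
    · exact absurd hlt (Nat.size_two_pow_xor hx.le).ge.not_gt
  · exact fun hy => ⟨Or.inl hy, Nat.lt_succ_of_le (size_le_of_mem_Y4 hy)⟩

/-- For Algorithm 4 and every `k ≥ 2`, `Z⁽ᵏ⁾ = {2^k ⊕ y : y ∈ Y⁽ᵏ⁻²⁾}`. -/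
theorem stmt_3 (k : ℕ) (hk : 2 ≤ k) :
    Z4 k = (Y4 (k - 2)).image (fun y => 2 ^ k ^^^ y) := by
  obtain ⟨m, rfl⟩ := Nat.exists_eq_add_of_le' hk
  exact congrArg (Finset.image fun y => 2 ^ (m + 2) ^^^ y) (filter_size_lt_Y4_succ m)
end

section
/- (Theorem 8) For Algorithm 4 and every k ≥ 0, the set Y⁽ᵏ⁾ is (k+1)-significance, i.e., every natural number less than 2^(k+1) is the exclusive-or of two elements of Y⁽ᵏ⁾. -/
/-- Every `x < 2 ^ (k + 1)` splits as `a ^^^ b` with `a, b ∈ Y4 k`, where `b` may moreover be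
chosen with its bit `k` unset. -/
theorem exists_mem_Y4_xor_of_lt (k x : ℕ) (hx : x < 2 ^ (k + 1)) :
    ∃ a ∈ Y4 k, ∃ b ∈ Y4 k, a < 2 ^ (k + 1) ∧ b < 2 ^ k ∧ x = a ^^^ b := by
  induction k generalizing x with
  | zero =>
    have hx' : x = 0 ∨ x = 1 := by omega
    exact ⟨x, by simpa [Y4] using hx', 0, by simp [Y4], hx, by simp, by simp⟩
  | succ k ih =>
    rcases lt_or_ge x (2 ^ (k + 1)) with h | h
    · obtain ⟨a, ha, b, hb, hal, hbl, rfl⟩ := ih x h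
      exact ⟨a, Finset.mem_union_left _ ha, b, Finset.mem_union_left _ hb,
        hal.trans (Nat.pow_lt_pow_right one_lt_two (Nat.lt_succ_self _)),
        hbl.trans (Nat.pow_lt_pow_right one_lt_two (Nat.lt_succ_self _)), rfl⟩
    · obtain ⟨y, rfl⟩ := Nat.exists_eq_add_of_le h
      have hy : y < 2 ^ (k + 1) := by rw [pow_succ 2 (k + 1)] at hx; omega
      have hxor : 2 ^ (k + 1) + y = 2 ^ (k + 1) ^^^ y := by
        have hor := Nat.two_pow_add_eq_or_of_lt hy 1
        rw [mul_one] at hor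
        rw [hor]
        refine Nat.eq_of_testBit_eq fun i => ?_
        rcases eq_or_ne (k + 1) i with rfl | hi
        · simp [Nat.testBit_lt_two_pow hy]
        · simp [Nat.testBit_two_pow_of_ne hi]
      obtain ⟨a, ha, b, hb, hal, hbl, rfl⟩ := ih y hy
      refine ⟨2 ^ (k + 1) ^^^ b, Finset.mem_union_right _ (Finset.mem_image_of_mem _
        (Finset.mem_filter.2 ⟨hb, Nat.lt_succ_of_le (Nat.size_le.2 hbl)⟩)),
        a, Finset.mem_union_left _ ha, ?_, hal, ?_⟩
      · exact Nat.xor_lt_two_pow (Nat.pow_lt_pow_right one_lt_two (Nat.lt_succ_self _))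
          (hbl.trans (Nat.pow_lt_pow_right one_lt_two (by omega)))
      · rw [hxor, Nat.xor_comm a b, Nat.xor_assoc]

/-- Theorem 8: for Algorithm 4 and every `k ≥ 0`, the set `Y⁽ᵏ⁾` is
`(k+1)`-significance: every natural number less than `2^(k+1)` is the
exclusive-or of two elements of `Y⁽ᵏ⁾`. -/
theorem stmt_4 (k : ℕ) (x : ℕ) (hx : x < 2 ^ (k + 1)) :
    ∃ a ∈ Y4 k, ∃ b ∈ Y4 k, x = a ^^^ b := by
  obtain ⟨a, ha, b, hb, -, -, h⟩ := exists_mem_Y4_xor_of_lt k x hx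
  exact ⟨a, ha, b, hb, h⟩
end

section
/- (Lemma 9) Let k ≥ 1 and let Y be a finite set of natural numbers such that (1) MSB(y) ≤ k for all y ∈ Y, and (2) Y is k-significance. Let A = {a ∈ Y : MSB(a) = k} and B = {b ∈ Y : MSB(b) < k}. Then every natural number x with 2^(k−1) ≤ x < 2^k belongs to the set X = {a ⊕ b : a ∈ A, b ∈ B}. -/
/-- If two numbers share their leading bit, it cancels in their exclusive-or. -/
theorem Nat.xor_lt_two_pow_of_size_eq {m a b : ℕ} (ha : Nat.size a = m + 1)
    (hb : Nat.size b = m + 1) : a ^^^ b < 2 ^ m := by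
  have leading : ∀ {c : ℕ}, Nat.size c = m + 1 → c / 2 ^ m = 1 := fun {c} hc => by
    have hlo : 2 ^ m ≤ c := Nat.lt_size.1 (by omega)
    have hhi : c < 2 ^ (m + 1) := Nat.size_le.1 hc.le
    exact Nat.div_eq_of_lt_le (by omega) (by rw [pow_succ] at hhi; omega)
  refine (Nat.div_eq_zero_iff_lt (by positivity)).1 ?_
  rw [Nat.xor_div_two_pow, leading ha, leading hb, Nat.xor_self]

/-- Lemma 9: if every element of `Y` has `MSB(y) ≤ k` and `Y` is
`k`-significance, then every `x` with `2^(k-1) ≤ x < 2^k` is the exclusive-or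
of an element of `A = {a ∈ Y : MSB(a) = k}` and an element of
`B = {b ∈ Y : MSB(b) < k}`. -/
theorem stmt_5 (k : ℕ) (hk : 1 ≤ k) (Y : Finset ℕ)
    (h1 : ∀ y ∈ Y, Nat.size y ≤ k)
    (h2 : ∀ s, s < 2 ^ k → ∃ a ∈ Y, ∃ b ∈ Y, s = a ^^^ b)
    (x : ℕ) (hx1 : 2 ^ (k - 1) ≤ x) (hx2 : x < 2 ^ k) :
    ∃ a ∈ Y, Nat.size a = k ∧ ∃ b ∈ Y, Nat.size b < k ∧ x = a ^^^ b := by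
  obtain ⟨m, rfl⟩ : ∃ m, k = m + 1 := ⟨k - 1, by omega⟩
  rw [Nat.add_sub_cancel] at hx1
  obtain ⟨a, ha, b, hb, rfl⟩ := h2 x hx2
  rcases (h1 a ha).lt_or_eq with ha' | ha' <;> rcases (h1 b hb).lt_or_eq with hb' | hb'
  · have := Nat.xor_lt_two_pow (Nat.size_le.1 (Nat.lt_succ_iff.1 ha'))
      (Nat.size_le.1 (Nat.lt_succ_iff.1 hb'))
    omega
  · exact ⟨b, hb, hb', a, ha, ha', Nat.xor_comm a b⟩
  · exact ⟨a, ha, ha', b, hb, hb', rfl⟩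
  · exact absurd (Nat.xor_lt_two_pow_of_size_eq ha' hb') hx1.not_gt
end

section
/- (Corollary 11) For Algorithm 4 and every k ≥ 0, the set Y⁽ᵏ⁾ is strictly (k+1)-significance, i.e., the covering set S(Y⁽ᵏ⁾) equals exactly {0, 1, …, 2^(k+1) − 1}. -/
theorem Y4_subset_succ (k : ℕ) : Y4 k ⊆ Y4 (k + 1) :=
  Finset.subset_union_left

theorem two_pow_xor_mem_Y4 {k y : ℕ} (hy : y ∈ Y4 k) (hlt : y < 2 ^ k) :
    2 ^ (k + 1) ^^^ y ∈ Y4 (k + 1) :=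
  Finset.mem_union_right _ <| Finset.mem_image_of_mem _ <|
    Finset.mem_filter.2 ⟨hy, Nat.lt_succ_of_le (Nat.size_le.2 hlt)⟩

/-- Every number below `2 ^ (k + 1)` is a xor of two elements of `Y4 k`,
the second of which may be chosen below `2 ^ k`. -/
theorem exists_mem_Y4_xor_eq {k x : ℕ} (hx : x < 2 ^ (k + 1)) :
    ∃ a ∈ Y4 k, ∃ b ∈ Y4 k, b < 2 ^ k ∧ a ^^^ b = x := by
  induction k generalizing x with
  | zero =>
    refine ⟨x, ?_, 0, by simp [Y4], by simp, Nat.xor_zero x⟩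
    simp only [Y4, Finset.mem_insert, Finset.mem_singleton]
    omega
  | succ k ih =>
    rcases lt_or_ge x (2 ^ (k + 1)) with hlt | hge
    · obtain ⟨a, ha, b, hb, hbk, rfl⟩ := ih hlt
      exact ⟨a, Y4_subset_succ k ha, b, Y4_subset_succ k hb,
        hbk.trans (Nat.pow_lt_pow_succ one_lt_two), rfl⟩
    · have hsub : x - 2 ^ (k + 1) < 2 ^ (k + 1) := by
        rw [pow_succ 2 (k + 1)] at hx
        omega
      have hxor : 2 ^ (k + 1) ^^^ (x - 2 ^ (k + 1)) = x := by
        have h := Nat.two_pow_add_eq_or_of_lt hsub 1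
        rw [mul_one, Nat.add_sub_cancel' hge] at h
        conv_rhs => rw [h]
        refine Nat.eq_of_testBit_eq fun i => ?_
        rw [Nat.testBit_xor, Nat.testBit_or, Nat.testBit_two_pow]
        by_cases hi : k + 1 = i
        · subst hi
          simp [Nat.testBit_lt_two_pow hsub]
        · simp [hi]
      obtain ⟨a, ha, b, hb, hbk, hab⟩ := ih hsub
      refine ⟨2 ^ (k + 1) ^^^ b, two_pow_xor_mem_Y4 hb hbk, a, Y4_subset_succ k ha,
        lt_two_pow_of_mem_Y4 ha, ?_⟩
      rw [Nat.xor_assoc, Nat.xor_comm b a, hab, hxor]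

/-- Corollary 11: for Algorithm 4 and every `k ≥ 0`, the set `Y⁽ᵏ⁾` is
strictly `(k+1)`-significance: its covering set is exactly `{0, …, 2^(k+1) − 1}`. -/
theorem stmt_6 (k : ℕ) : coveringSet (Y4 k) = Finset.range (2 ^ (k + 1)) := by
  ext x
  simp only [coveringSet, Finset.mem_image₂, Finset.mem_range]
  constructor
  · rintro ⟨a, ha, b, hb, rfl⟩
    exact Nat.xor_lt_two_pow (lt_two_pow_of_mem_Y4 ha) (lt_two_pow_of_mem_Y4 hb)
  · intro hx
    obtain ⟨a, ha, b, hb, -, hab⟩ := exists_mem_Y4_xor_eq hx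
    exact ⟨a, ha, b, hb, hab⟩
end

section
/- For Algorithm 4, the cardinalities satisfy |Y⁽⁰⁾| = 2, |Y⁽¹⁾| = 3, and |Y⁽ᵏ⁾| = |Y⁽ᵏ⁻¹⁾| + |Y⁽ᵏ⁻²⁾| for every k ≥ 2 (so they form a Fibonacci sequence). -/
theorem two_pow_le_two_pow_xor {n y : ℕ} (hy : y < 2 ^ n) : 2 ^ n ≤ 2 ^ n ^^^ y := by
  apply Nat.ge_two_pow_of_testBit
  simp [Nat.testBit_xor, Nat.testBit_lt_two_pow hy]

theorem card_Y4_succ (k : ℕ) :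
    (Y4 (k + 1)).card =
      (Y4 k).card + ((Y4 k).filter (fun y => Nat.size y < k + 1)).card := by
  rw [Y4, Finset.card_union_of_disjoint, Finset.card_image_of_injective _ Nat.xor_right_injective]
  rw [Finset.disjoint_left]
  intro x hx hx'
  simp only [Finset.mem_image, Finset.mem_filter] at hx'
  obtain ⟨z, ⟨hz, -⟩, rfl⟩ := hx'
  exact (lt_two_pow_of_mem_Y4 hx).not_ge (two_pow_le_two_pow_xor (lt_two_pow_of_mem_Y4 hz))

/-- For Algorithm 4, the cardinalities satisfy `|Y⁽⁰⁾| = 2`, `|Y⁽¹⁾| = 3`, and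
`|Y⁽ᵏ⁾| = |Y⁽ᵏ⁻¹⁾| + |Y⁽ᵏ⁻²⁾|` for `k ≥ 2` (a Fibonacci sequence). -/
theorem stmt_7 :
    (Y4 0).card = 2 ∧ (Y4 1).card = 3 ∧
      ∀ k, 2 ≤ k → (Y4 k).card = (Y4 (k - 1)).card + (Y4 (k - 2)).card := by
  refine ⟨rfl, by simp [Y4, Finset.filter_insert, Finset.filter_singleton], ?_⟩
  intro k hk
  obtain ⟨m, rfl⟩ := Nat.exists_eq_add_of_le' hk
  change (Y4 (m + 1 + 1)).card = (Y4 (m + 1)).card + (Y4 m).card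
  rw [card_Y4_succ, filter_size_lt_Y4_succ]
end

section
/- For Algorithm 5 and every k ≥ 3, one has Z⁽ᵏ⁾ = {2^(k+1) ⊕ z : z ∈ Z⁽ᵏ⁻²⁾} ∪ {2^(k+1) ⊕ 2^(k−1) ⊕ z : z ∈ Z⁽ᵏ⁻²⁾}. -/
/-- The sets `Y⁽ᵏ⁾` of Algorithm 5. -/
def Y5 : ℕ → Finset ℕ
  | 0 => {0, 1, 2}
  | k + 1 =>
      Y5 k ∪
        (((Y5 k).filter (fun y => Nat.size y = k + 1)).image
            (fun y => 2 ^ (k + 2) ^^^ y) ∪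
          ((Y5 k).filter (fun y => Nat.size y = k + 1)).image
            (fun y => 2 ^ (k + 2) ^^^ 2 ^ k ^^^ y))

/-- The sets `Z⁽ᵏ⁾` of Algorithm 5 (for `k ≥ 1`). -/
def Z5 (k : ℕ) : Finset ℕ :=
  ((Y5 (k - 1)).filter (fun y => Nat.size y = k)).image
      (fun y => 2 ^ (k + 1) ^^^ y) ∪
    ((Y5 (k - 1)).filter (fun y => Nat.size y = k)).image
      (fun y => 2 ^ (k + 1) ^^^ 2 ^ (k - 1) ^^^ y)

theorem Nat.size_two_pow_xor_of_lt {n y : ℕ} (hy : y < 2 ^ n) :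
    Nat.size (2 ^ n ^^^ y) = n + 1 := by
  apply le_antisymm
  · rw [Nat.size_le]
    exact Nat.xor_lt_two_pow (Nat.pow_lt_pow_right (by norm_num) n.lt_succ_self)
      (hy.trans (Nat.pow_lt_pow_right (by norm_num) n.lt_succ_self))
  · rw [Nat.succ_le_iff, Nat.lt_size]
    apply Nat.ge_two_pow_of_testBit
    simp [Nat.testBit_xor, Nat.testBit_lt_two_pow hy]

theorem Y5_succ (k : ℕ) : Y5 (k + 1) = Y5 k ∪ Z5 (k + 1) := rfl

theorem size_of_mem_Z5_succ {k z : ℕ} (hz : z ∈ Z5 (k + 1)) : Nat.size z = k + 3 := by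
  have hlt {y : ℕ} (hy : Nat.size y = k + 1) : y < 2 ^ (k + 2) :=
    Nat.size_le.1 (by omega)
  simp only [Z5, Finset.mem_union, Finset.mem_image, Finset.mem_filter,
    Nat.add_sub_cancel] at hz
  obtain ⟨y, ⟨-, hy⟩, rfl⟩ | ⟨y, ⟨-, hy⟩, rfl⟩ := hz
  · exact Nat.size_two_pow_xor_of_lt (hlt hy)
  · rw [Nat.xor_assoc]
    exact Nat.size_two_pow_xor_of_lt
      (Nat.xor_lt_two_pow (Nat.pow_lt_pow_right (by norm_num) (by omega)) (hlt hy))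

theorem size_le_of_mem_Y5 {k y : ℕ} (hy : y ∈ Y5 k) : Nat.size y ≤ k + 2 := by
  induction k with
  | zero =>
    simp only [Y5, Finset.mem_insert, Finset.mem_singleton] at hy
    rw [Nat.size_le]
    omega
  | succ k ih =>
    rw [Y5_succ, Finset.mem_union] at hy
    obtain hy | hy := hy
    · exact (ih hy).trans (by omega)
    · exact (size_of_mem_Z5_succ hy).le

theorem filter_size_Y5 (k : ℕ) :
    (Y5 (k + 2)).filter (fun y => Nat.size y = k + 3) = Z5 (k + 1) := by
  ext y
  rw [Finset.mem_filter, Y5_succ, Y5_succ, Finset.mem_union, Finset.mem_union]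
  constructor
  · rintro ⟨(hy | hy) | hy, hs⟩
    · have := size_le_of_mem_Y5 hy
      omega
    · exact hy
    · have := size_of_mem_Z5_succ hy
      omega
  · exact fun hy => ⟨.inl (.inr hy), size_of_mem_Z5_succ hy⟩

/-- For Algorithm 5 and every `k ≥ 3`,
`Z⁽ᵏ⁾ = {2^(k+1) ⊕ z : z ∈ Z⁽ᵏ⁻²⁾} ∪ {2^(k+1) ⊕ 2^(k−1) ⊕ z : z ∈ Z⁽ᵏ⁻²⁾}`. -/
theorem stmt_10 (k : ℕ) (hk : 3 ≤ k) :
    Z5 k =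
      (Z5 (k - 2)).image (fun z => 2 ^ (k + 1) ^^^ z) ∪
        (Z5 (k - 2)).image (fun z => 2 ^ (k + 1) ^^^ 2 ^ (k - 1) ^^^ z) := by
  obtain ⟨k, rfl⟩ := Nat.exists_eq_add_of_le' hk
  rw [Z5, show k + 3 - 1 = k + 2 from rfl, show k + 3 - 2 = k + 1 from rfl, filter_size_Y5]
end

section
/- For Algorithm 5, for every k ≥ 0 and every y ∈ Y⁽ᵏ⁾ with m := MSB(y) ≥ 2, the bit of y at 1-based position m − 1 (the bit immediately below its most significant bit, i.e., Nat.testBit y (m − 2)) equals 0. -/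
theorem Nat.size_two_pow_xor_s11 {n z : ℕ} (hz : z < 2 ^ n) :
    Nat.size (2 ^ n ^^^ z) = n + 1 := by
  have hlt : 2 ^ n ^^^ z < 2 ^ (n + 1) :=
    Nat.xor_lt_two_pow (Nat.pow_lt_pow_right (by decide) n.lt_succ_self)
      (hz.trans (Nat.pow_lt_pow_right (by decide) n.lt_succ_self))
  have hbit : (2 ^ n ^^^ z).testBit n = true := by
    simp [Nat.testBit_xor, Nat.testBit_lt_two_pow hz]
  exact le_antisymm (Nat.size_le.2 hlt) (Nat.lt_size.2 (Nat.ge_two_pow_of_testBit hbit))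

theorem Nat.testBit_size_sub_two_two_pow_xor {n z : ℕ} (hz : z < 2 ^ n) :
    (2 ^ (n + 1) ^^^ z).testBit (Nat.size (2 ^ (n + 1) ^^^ z) - 2) = false := by
  rw [Nat.size_two_pow_xor_s11 (hz.trans (Nat.pow_lt_pow_right (by decide) n.lt_succ_self))]
  simp [Nat.testBit_xor, Nat.testBit_lt_two_pow hz]

/-- For Algorithm 5, every `y ∈ Y⁽ᵏ⁾` with `m := MSB(y) ≥ 2` has its bit at
1-based position `m − 1` (i.e. `Nat.testBit y (m − 2)`) equal to `0`. -/
theorem stmt_11 (k : ℕ) (y : ℕ) (hy : y ∈ Y5 k) (hm : 2 ≤ Nat.size y) :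
    Nat.testBit y (Nat.size y - 2) = false := by
  induction k with
  | zero =>
    simp only [Y5, Finset.mem_insert, Finset.mem_singleton] at hy
    rcases hy with rfl | rfl | rfl
    · simp
    · simp at hm
    · exact Nat.testBit_size_sub_two_two_pow_xor (n := 0) (z := 0) (by decide)
  | succ k ih =>
    simp only [Y5, Finset.mem_union, Finset.mem_image, Finset.mem_filter] at hy
    rcases hy with hy | ⟨x, ⟨-, hx⟩, rfl⟩ | ⟨x, ⟨-, hx⟩, rfl⟩
    · exact ih hy
    · exact Nat.testBit_size_sub_two_two_pow_xor (Nat.size_le.1 hx.le)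
    · rw [Nat.xor_assoc]
      exact Nat.testBit_size_sub_two_two_pow_xor
        (Nat.xor_lt_two_pow (Nat.pow_lt_pow_right (by decide) k.lt_succ_self)
          (Nat.size_le.1 hx.le))
end

section
/- (Theorem 13) For Algorithm 5 and every k ≥ 0, the set Y⁽ᵏ⁾ is (k+2)-significance, i.e., every natural number less than 2^(k+2) is the exclusive-or of two elements of Y⁽ᵏ⁾. -/
/-- A number below `2 ^ (n + 1)` whose bit `n` is set has exactly `n + 1` binary digits. -/
theorem Nat.size_eq_succ_of_testBit {z n : ℕ} (hz : z < 2 ^ (n + 1)) (hn : z.testBit n = true) :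
    Nat.size z = n + 1 :=
  le_antisymm (Nat.size_le.2 hz) (Nat.lt_size.2 (Nat.ge_two_pow_of_testBit hn))

/-- `Y⁽ᵏ⁾` contains every number below `2 ^ (k + 2)` whose binary digits `1` all stand at
positions of the same parity. -/
theorem mem_Y5_of_parity (r k : ℕ) : ∀ y < 2 ^ (k + 2),
    (∀ i, y.testBit i = true → i % 2 = r) → y ∈ Y5 k := by
  induction k with
  | zero =>
    intro y hy hr
    have h0 := hr 0
    have h1 := hr 1
    norm_num at hy
    interval_cases y <;> simp_all [Y5, Nat.testBit] <;> omega
  | succ k ih =>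
    intro y hy hr
    rw [Y5, Finset.mem_union, Finset.mem_union]
    by_cases hlt : y < 2 ^ (k + 2)
    · exact Or.inl (ih y hlt hr)
    have htop : y.testBit (k + 2) = true := by
      by_contra h
      refine hlt (Nat.lt_pow_two_of_testBit y fun i hi => ?_)
      rcases hi.eq_or_lt with rfl | hi
      · simpa using h
      · exact Nat.testBit_lt_two_pow (hy.trans_le (Nat.pow_le_pow_right two_pos hi))
    have hpar := hr _ htop
    have key : ∀ z : ℕ, (∀ i, z.testBit i = if i = k then true else
        if i = k + 2 then false else y.testBit i) → z ∈ (Y5 k).filter (Nat.size · = k + 1) := by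
      intro z hz
      have hzlt : z < 2 ^ (k + 1) := by
        refine Nat.lt_pow_two_of_testBit z fun i hi => ?_
        rw [hz, if_neg (by omega)]
        split_ifs with h
        · rfl
        rcases hi.eq_or_lt with rfl | hi
        · by_contra hb
          have := hr _ (by simpa using hb)
          omega
        · exact Nat.testBit_lt_two_pow
            (hy.trans_le (Nat.pow_le_pow_right two_pos (by omega)))
      refine Finset.mem_filter.2 ⟨ih z (hzlt.trans (Nat.pow_lt_pow_right one_lt_two (by omega)))
        fun i hi => ?_, Nat.size_eq_succ_of_testBit hzlt (by simp [hz])⟩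
      rw [hz] at hi
      split_ifs at hi with h
      · omega
      · exact hr i hi
    right
    by_cases hk : y.testBit k = true
    · refine Or.inl (Finset.mem_image.2 ⟨2 ^ (k + 2) ^^^ y, key _ fun i => ?_,
        Nat.xor_xor_cancel_left _ _⟩)
      rw [Nat.testBit_xor, Nat.testBit_two_pow]
      grind
    · refine Or.inr (Finset.mem_image.2 ⟨2 ^ (k + 2) ^^^ 2 ^ k ^^^ y, key _ fun i => ?_,
        Nat.xor_xor_cancel_left _ _⟩)
      rw [Nat.testBit_xor, Nat.testBit_xor, Nat.testBit_two_pow, Nat.testBit_two_pow]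
      grind

/-- The digits of `x` below position `n` that stand at positions congruent to `r` modulo `2`. -/
def parityPart (n r x : ℕ) : ℕ :=
  Nat.ofBits fun i : Fin n => x.testBit i && decide (i.val % 2 = r)

theorem testBit_parityPart (n r x i : ℕ) :
    (parityPart n r x).testBit i = (decide (i < n) && (x.testBit i && decide (i % 2 = r))) := by
  by_cases h : i < n
  · simp [parityPart, Nat.testBit_ofBits_lt _ _ h, h]
  · simp [parityPart, Nat.testBit_ofBits_ge _ _ (not_lt.1 h), h]

theorem parityPart_mem_Y5 (k r x : ℕ) : parityPart (k + 2) r x ∈ Y5 k := by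
  refine mem_Y5_of_parity r k _ (Nat.ofBits_lt_two_pow _) fun i hi => ?_
  rw [testBit_parityPart] at hi
  simp_all

theorem parityPart_xor_parityPart {n x : ℕ} (hx : x < 2 ^ n) :
    parityPart n 0 x ^^^ parityPart n 1 x = x := by
  refine Nat.eq_of_testBit_eq fun i => ?_
  rw [Nat.testBit_xor, testBit_parityPart, testBit_parityPart]
  by_cases h : i < n
  · rcases Nat.mod_two_eq_zero_or_one i with hi | hi <;> simp [h, hi]
  · simp [h, Nat.testBit_lt_two_pow (hx.trans_le (Nat.pow_le_pow_right two_pos (not_lt.1 h)))]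

/-- Theorem 13: for Algorithm 5 and every `k ≥ 0`, the set `Y⁽ᵏ⁾` is
`(k+2)`-significance: every natural number less than `2^(k+2)` is the
exclusive-or of two elements of `Y⁽ᵏ⁾`. -/
theorem stmt_14 (k : ℕ) (x : ℕ) (hx : x < 2 ^ (k + 2)) :
    ∃ a ∈ Y5 k, ∃ b ∈ Y5 k, x = a ^^^ b :=
  ⟨_, parityPart_mem_Y5 k 0 x, _, parityPart_mem_Y5 k 1 x, (parityPart_xor_parityPart hx).symm⟩
end

section
/- (Lemma 14) Let k ≥ 2 and let Y be a finite set of natural numbers such that (1) MSB(y) ≤ k for all y ∈ Y, (2) Y is k-significance, and (3) every y ∈ Y with MSB(y) = k has its bit at 1-based position k − 1 equal to 0 (i.e., Nat.testBit y (k − 2) = false). Let D = {y ∈ Y : MSB(y) = k} and E = {y ∈ Y : MSB(y) = k − 1}. Then every natural number x with 2^(k−1) + 2^(k−2) ≤ x < 2^k belongs to the set U = {d ⊕ e : d ∈ D, e ∈ E}. -/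
theorem Nat.size_eq_succ_of_testBit_s15 {n y : ℕ} (hy : y < 2 ^ (n + 1))
    (h : Nat.testBit y n = true) : Nat.size y = n + 1 :=
  le_antisymm (Nat.size_le.2 hy) (Nat.lt_size.2 (Nat.ge_two_pow_of_testBit h))

theorem Nat.testBit_of_two_pow_le_of_lt {n y : ℕ} (hle : 2 ^ n ≤ y)
    (hlt : y < 2 ^ (n + 1)) : Nat.testBit y n = true := by
  have h : y / 2 ^ n = 1 :=
    Nat.div_eq_of_lt_le (by simpa using hle) (by rw [pow_succ] at hlt; omega)
  simp [Nat.testBit_eq_decide_div_mod_eq, h]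

/-- Lemma 14: if every element of `Y` has `MSB(y) ≤ k`, `Y` is
`k`-significance, and every `y ∈ Y` with `MSB(y) = k` has the bit just below
its most significant bit equal to `0`, then every `x` with
`2^(k−1) + 2^(k−2) ≤ x < 2^k` is the exclusive-or of an element of
`D = {y ∈ Y : MSB(y) = k}` and an element of `E = {y ∈ Y : MSB(y) = k − 1}`. -/
theorem stmt_15 (k : ℕ) (hk : 2 ≤ k) (Y : Finset ℕ)
    (h1 : ∀ y ∈ Y, Nat.size y ≤ k)
    (h2 : ∀ s, s < 2 ^ k → ∃ a ∈ Y, ∃ b ∈ Y, s = a ^^^ b)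
    (h3 : ∀ y ∈ Y, Nat.size y = k → Nat.testBit y (k - 2) = false)
    (x : ℕ) (hx1 : 2 ^ (k - 1) + 2 ^ (k - 2) ≤ x) (hx2 : x < 2 ^ k) :
    ∃ d ∈ Y, Nat.size d = k ∧ ∃ e ∈ Y, Nat.size e = k - 1 ∧ x = d ^^^ e := by
  obtain ⟨m, rfl⟩ : ∃ m, k = m + 2 := ⟨k - 2, by omega⟩
  simp only [Nat.add_sub_cancel, show m + 2 - 1 = m + 1 by omega] at *
  have hxtop : Nat.testBit x (m + 1) = true :=
    Nat.testBit_of_two_pow_le_of_lt (by omega) hx2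
  have hxnext : Nat.testBit x m = true := by
    obtain ⟨r, rfl⟩ : ∃ r, x = 2 ^ (m + 1) + r := ⟨x - 2 ^ (m + 1), by omega⟩
    rw [Nat.testBit_two_pow_add_gt (Nat.lt_succ_self m)]
    refine Nat.testBit_of_two_pow_le_of_lt (by omega) ?_
    have : 2 ^ (m + 2) = 2 * 2 ^ (m + 1) := by ring
    omega
  have key : ∀ a ∈ Y, ∀ b ∈ Y, x = a ^^^ b → Nat.testBit a (m + 1) = true →
      Nat.testBit b (m + 1) = false →
      ∃ d ∈ Y, Nat.size d = m + 2 ∧ ∃ e ∈ Y, Nat.size e = m + 1 ∧ x = d ^^^ e := by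
    intro a ha b hb hab hatop hbtop
    have hsize : Nat.size a = m + 2 :=
      Nat.size_eq_succ_of_testBit_s15 (Nat.size_le.1 (h1 a ha)) hatop
    have hbnext : Nat.testBit b m = true := by
      simpa [hab, Nat.testBit_xor, h3 a ha hsize] using hxnext
    have hblt : b < 2 ^ (m + 1) := by
      by_contra! hle
      simp [Nat.testBit_of_two_pow_le_of_lt hle (Nat.size_le.1 (h1 b hb))] at hbtop
    exact ⟨a, ha, hsize, b, hb, Nat.size_eq_succ_of_testBit_s15 hblt hbnext, hab⟩
  obtain ⟨a, ha, b, hb, hab⟩ := h2 x hx2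
  have hxor : (Nat.testBit a (m + 1) ^^ Nat.testBit b (m + 1)) = true := by
    rw [← Nat.testBit_xor, ← hab, hxtop]
  cases hatop : Nat.testBit a (m + 1) <;> cases hbtop : Nat.testBit b (m + 1) <;>
    simp [hatop, hbtop] at hxor
  · exact key b hb a ha (by rw [hab, Nat.xor_comm]) hbtop hatop
  · exact key a ha b hb hab hatop hbtop
end

section
/- (Corollary 16) For Algorithm 5 and every k ≥ 0, the set Y⁽ᵏ⁾ is strictly (k+2)-significance, i.e., the covering set S(Y⁽ᵏ⁾) equals exactly {0, 1, …, 2^(k+2) − 1}. -/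
theorem Y5_lt_two_pow {k y : ℕ} (hy : y ∈ Y5 k) : y < 2 ^ (k + 2) := by
  induction k generalizing y with
  | zero => simp only [Y5, Finset.mem_insert, Finset.mem_singleton] at hy; omega
  | succ k ih =>
    have hk2 : 2 ^ (k + 2) < 2 ^ (k + 1 + 2) := Nat.pow_lt_pow_right (by norm_num) (by omega)
    have hk : 2 ^ k < 2 ^ (k + 1 + 2) := Nat.pow_lt_pow_right (by norm_num) (by omega)
    simp only [Y5, Finset.mem_union, Finset.mem_image, Finset.mem_filter] at hy
    rcases hy with hy | ⟨a, ⟨ha, -⟩, rfl⟩ | ⟨a, ⟨ha, -⟩, rfl⟩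
    · exact (ih hy).trans hk2
    · exact Nat.xor_lt_two_pow hk2 ((ih ha).trans hk2)
    · exact Nat.xor_lt_two_pow (Nat.xor_lt_two_pow hk2 hk) ((ih ha).trans hk2)

/-- `Y5 k` contains every number below `2 ^ (k + 2)` whose binary ones all lie in positions of the
same parity. -/
theorem mem_Y5_of_testBit_parity {k y p : ℕ} (hy : y < 2 ^ (k + 2))
    (hp : ∀ i, y.testBit i = true → i % 2 = p) : y ∈ Y5 k := by
  induction k generalizing y p with
  | zero =>
    have h0 := hp 0
    have h1 := hp 1
    have : y < 4 := hy
    interval_cases y <;> simp_all [Y5, Nat.testBit]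
    omega
  | succ k ih =>
    by_cases hlt : y < 2 ^ (k + 2)
    · exact Finset.mem_union_left _ (ih hlt hp)
    have htop : y.testBit (k + 2) = true := by
      obtain ⟨i, hi, hbit⟩ := Nat.exists_ge_and_testBit_of_ge_two_pow (not_lt.mp hlt)
      have : i < k + 3 := by
        by_contra! h
        rw [Nat.testBit_lt_two_pow (hy.trans_le (Nat.pow_le_pow_right (by norm_num) h))] at hbit
        simp at hbit
      rwa [show k + 2 = i by omega]
    have hpk : (k + 2) % 2 = p := hp _ htop
    have hmid : y.testBit (k + 1) = false := by
      by_contra h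
      have := hp (k + 1) (by simpa using h)
      omega
    have hhigh (i : ℕ) (hi : k + 2 < i) : y.testBit i = false :=
      Nat.testBit_lt_two_pow (hy.trans_le (Nat.pow_le_pow_right (by norm_num) hi))
    set a := y % 2 ^ k ^^^ 2 ^ k with ha
    have hbit (i : ℕ) : a.testBit i = ((decide (i < k) && y.testBit i) ^^ decide (k = i)) := by
      rw [ha, Nat.testBit_xor, Nat.testBit_mod_two_pow, Nat.testBit_two_pow]
    have ha_lt : a < 2 ^ (k + 1) :=
      Nat.xor_lt_two_pow
        ((Nat.mod_lt _ (by positivity)).trans (Nat.pow_lt_pow_right (by norm_num) (by omega)))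
        (Nat.pow_lt_pow_right (by norm_num) (by omega))
    have ha_ge : 2 ^ k ≤ a := Nat.ge_two_pow_of_testBit (by simp [hbit])
    have ha_size : a.size = k + 1 :=
      le_antisymm (Nat.size_le.mpr ha_lt) (Nat.lt_size.mpr ha_ge)
    have ha_mem : a ∈ Y5 k := by
      refine ih (p := p) (ha_lt.trans (Nat.pow_lt_pow_right (by norm_num) (by omega))) fun i hi => ?_
      rw [hbit] at hi
      by_cases hik : k = i
      · omega
      · exact hp i (by simp_all)
    refine Finset.mem_union_right _ ?_
    rw [Finset.mem_union, Finset.mem_image, Finset.mem_image]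
    have ha_filter : a ∈ (Y5 k).filter (fun y => Nat.size y = k + 1) :=
      Finset.mem_filter.mpr ⟨ha_mem, ha_size⟩
    have hcases (i : ℕ) : i < k ∨ i = k ∨ i = k + 1 ∨ i = k + 2 ∨ k + 2 < i := by omega
    cases hyk : y.testBit k with
    | true =>
      refine Or.inl ⟨a, ha_filter, Nat.eq_of_testBit_eq fun i => ?_⟩
      rw [Nat.testBit_xor, Nat.testBit_two_pow, hbit]
      rcases hcases i with h | rfl | rfl | rfl | h <;> grind
    | false =>
      refine Or.inr ⟨a, ha_filter, Nat.eq_of_testBit_eq fun i => ?_⟩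
      rw [Nat.testBit_xor, Nat.testBit_xor, Nat.testBit_two_pow, Nat.testBit_two_pow, hbit]
      rcases hcases i with h | rfl | rfl | rfl | h <;> grind

/-- Every `x < 2 ^ n` is the exclusive-or of its ones in even and in odd positions. -/
theorem exists_xor_eq_of_lt_two_pow {n x : ℕ} (hx : x < 2 ^ n) :
    ∃ a < 2 ^ n, ∃ b < 2 ^ n, (∀ i, a.testBit i = true → i % 2 = 0) ∧
      (∀ i, b.testBit i = true → i % 2 = 1) ∧ a ^^^ b = x := by
  have hbit (p i : ℕ) : (Nat.ofBits fun j : Fin n => x.testBit j && decide (j.val % 2 = p)).testBit i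
      = (x.testBit i && decide (i % 2 = p)) := by
    rcases lt_or_ge i n with h | h
    · rw [Nat.testBit_ofBits_lt _ _ h]
    · rw [Nat.testBit_ofBits_ge _ _ h,
        Nat.testBit_lt_two_pow (hx.trans_le (Nat.pow_le_pow_right (by norm_num) h)), Bool.false_and]
  refine ⟨_, Nat.ofBits_lt_two_pow fun j : Fin n => x.testBit j && decide (j.val % 2 = 0),
    _, Nat.ofBits_lt_two_pow fun j : Fin n => x.testBit j && decide (j.val % 2 = 1),
    fun i hi => ?_, fun i hi => ?_, Nat.eq_of_testBit_eq fun i => ?_⟩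
  · simp_all
  · simp_all
  · rw [Nat.testBit_xor, hbit, hbit]
    rcases Nat.mod_two_eq_zero_or_one i with h | h <;> simp [h]

/-- Corollary 16: for Algorithm 5 and every `k ≥ 0`, the set `Y⁽ᵏ⁾` is
strictly `(k+2)`-significance: its covering set is exactly `{0, …, 2^(k+2) − 1}`. -/
theorem stmt_16 (k : ℕ) : coveringSet (Y5 k) = Finset.range (2 ^ (k + 2)) := by
  ext x
  rw [coveringSet, Finset.mem_image₂, Finset.mem_range]
  constructor
  · rintro ⟨a, ha, b, hb, rfl⟩
    exact Nat.xor_lt_two_pow (Y5_lt_two_pow ha) (Y5_lt_two_pow hb)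
  · intro hx
    obtain ⟨a, ha, b, hb, hpa, hpb, hab⟩ := exists_xor_eq_of_lt_two_pow hx
    exact ⟨a, mem_Y5_of_testBit_parity ha hpa, b, mem_Y5_of_testBit_parity hb hpb, hab⟩
end

section
/- (Combinatorial core of Theorem 17) For every n ≥ 3 there exists a finite set Y of natural numbers, each less than 2^n, with |Y| = 2^⌈n/2⌉ + 2^⌊n/2⌋ − 1, such that every natural number less than 2^n is the exclusive-or of two elements of Y; consequently a classical deterministic algorithm can solve Simon's problem with O(√(2^n)) queries. -/
theorem Nat.mod_two_pow_xor_div_mul (x p : ℕ) :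
    (x % 2 ^ p) ^^^ (x / 2 ^ p * 2 ^ p) = x := by
  refine Nat.eq_of_testBit_eq fun i => ?_
  rw [Nat.testBit_xor, Nat.testBit_mod_two_pow, Nat.testBit_mul_two_pow, Nat.testBit_div_two_pow]
  by_cases h : i < p
  · simp [h, not_le.mpr h]
  · simp [h, not_lt.mp h, Nat.sub_add_cancel]

/-- Combinatorial core of Theorem 17: for every `n ≥ 3` there is a finite set
`Y` of `n`-bit strings with `|Y| = 2^⌈n/2⌉ + 2^⌊n/2⌋ − 1` whose covering set
contains every natural number less than `2^n`; hence a classical deterministic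
algorithm solves Simon's problem with `O(√(2^n))` queries. -/
theorem stmt_17 (n : ℕ) (hn : 3 ≤ n) :
    ∃ Y : Finset ℕ,
      (∀ y ∈ Y, y < 2 ^ n) ∧
        Y.card = 2 ^ ((n + 1) / 2) + 2 ^ (n / 2) - 1 ∧
          ∀ x, x < 2 ^ n → ∃ a ∈ Y, ∃ b ∈ Y, x = a ^^^ b := by
  obtain ⟨p, hp⟩ : ∃ p, p = (n + 1) / 2 := ⟨_, rfl⟩
  obtain ⟨q, hq⟩ : ∃ q, q = n / 2 := ⟨_, rfl⟩
  have hpow : 2 ^ n = 2 ^ q * 2 ^ p := by rw [← pow_add]; congr 1; omega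
  have hp0 : 0 < 2 ^ p := by positivity
  have hq0 : 0 < 2 ^ q := by positivity
  rw [← hp, ← hq, hpow]
  refine ⟨Finset.range (2 ^ p) ∪ (Finset.Ico 1 (2 ^ q)).image (· * 2 ^ p), ?_, ?_, ?_⟩
  · intro y hy
    simp only [Finset.mem_union, Finset.mem_range, Finset.mem_image, Finset.mem_Ico] at hy
    rcases hy with hy | ⟨b, ⟨-, hb⟩, rfl⟩
    · nlinarith
    · exact Nat.mul_lt_mul_of_pos_right hb hp0
  · rw [Finset.card_union_of_disjoint, Finset.card_range, Finset.card_image_of_injective,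
      Nat.card_Ico]
    · omega
    · exact fun a b hab => Nat.eq_of_mul_eq_mul_right hp0 hab
    · rw [Finset.disjoint_left]
      intro y hy hy'
      simp only [Finset.mem_range, Finset.mem_image, Finset.mem_Ico] at hy hy'
      obtain ⟨b, ⟨hb, -⟩, rfl⟩ := hy'
      nlinarith
  · intro x hx
    refine ⟨x % 2 ^ p, ?_, x / 2 ^ p * 2 ^ p, ?_, (Nat.mod_two_pow_xor_div_mul x p).symm⟩
    · exact Finset.mem_union_left _ (Finset.mem_range.mpr (Nat.mod_lt _ hp0))
    · rcases Nat.eq_zero_or_pos (x / 2 ^ p) with h | h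
      · rw [h, zero_mul]
        exact Finset.mem_union_left _ (Finset.mem_range.mpr hp0)
      · exact Finset.mem_union_right _ (Finset.mem_image_of_mem _
          (Finset.mem_Ico.mpr ⟨h, Nat.div_lt_of_lt_mul (by rwa [mul_comm])⟩))
end

section
/- (Equation 3 solves Equation 2) Let n and l be integers with 1 ≤ l ≤ n − 1, and write t = 2^(n−l) as a real number (so t ≥ 2). Set φ = 2·arctan(√(t / (3t − 4))) and ψ = arccos((t/2 − 1)/(t − 1)). Then, as complex numbers, e^{iψ}·(1 − e^{iφ})·(1 − 1/t) = (1 − e^{iφ})·(1 − 1/t) + e^{iφ}, where e^{iθ} denotes Complex.exp(θ·I) for the indicated real θ and 1/t = 2^(l−n). -/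
open Real Complex

theorem phase_angles_eq {t : ℝ} (ht : 2 ≤ t) :
    2 * Real.arctan (√(t / (3 * t - 4))) = Real.arccos ((t / 2 - 1) / (t - 1)) := by
  have h₁ : 0 < t - 1 := by linarith
  have h₂ : 0 < 3 * t - 4 := by linarith
  have hcos : Real.cos (2 * Real.arctan (√(t / (3 * t - 4)))) = (t / 2 - 1) / (t - 1) := by
    have h₃ : 1 + t / (3 * t - 4) = 4 * (t - 1) / (3 * t - 4) := by
      rw [eq_div_iff h₂.ne', add_mul, div_mul_cancel₀ _ h₂.ne']
      ring
    rw [Real.cos_two_mul, Real.cos_sq_arctan, Real.sq_sqrt (by positivity), h₃]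
    field_simp
    ring
  rw [← hcos, Real.arccos_cos]
  · have := Real.arctan_nonneg.2 (Real.sqrt_nonneg (t / (3 * t - 4)))
    linarith
  · have := Real.arctan_lt_pi_div_two (√(t / (3 * t - 4)))
    linarith

theorem exp_mul_I_sq_add_one (θ : ℝ) :
    Complex.exp (θ * Complex.I) ^ 2 + 1 =
      2 * (Real.cos θ : ℂ) * Complex.exp (θ * Complex.I) := by
  rw [Complex.ofReal_cos, Complex.two_cos, add_mul, ← Complex.exp_add, ← Complex.exp_add, sq,
    ← Complex.exp_add]
  simp

/-- Equation 3 solves Equation 2: with `t = 2^(n−l)` (as a real number),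
`φ = 2·arctan(√(t/(3t − 4)))` and `ψ = arccos((t/2 − 1)/(t − 1))` satisfy the
amplitude-amplification phase condition
`e^{iψ}(1 − e^{iφ})(1 − 1/t) = (1 − e^{iφ})(1 − 1/t) + e^{iφ}`. -/
theorem stmt_18 (n l : ℕ) (hl : 1 ≤ l) (hln : l ≤ n - 1)
    (t : ℝ) (ht : t = (2 : ℝ) ^ (n - l))
    (φ ψ : ℝ)
    (hφ : φ = 2 * Real.arctan (Real.sqrt (t / (3 * t - 4))))
    (hψ : ψ = Real.arccos ((t / 2 - 1) / (t - 1))) :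
    Complex.exp (ψ * Complex.I) * (1 - Complex.exp (φ * Complex.I)) *
        (1 - 1 / (t : ℂ)) =
      (1 - Complex.exp (φ * Complex.I)) * (1 - 1 / (t : ℂ)) +
        Complex.exp (φ * Complex.I) := by
  have h2t : 2 ≤ t := by
    rw [ht]
    exact le_self_pow₀ one_le_two (by omega)
  have hφψ : φ = ψ := by rw [hφ, hψ, phase_angles_eq h2t]
  have hcos : Real.cos ψ = (t / 2 - 1) / (t - 1) := by
    rw [hψ, Real.cos_arccos]
    · rw [le_div_iff₀ (by linarith)]
      linarith
    · rw [div_le_iff₀ (by linarith)]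
      linarith
  have ht₀ : (t : ℂ) ≠ 0 := by
    exact_mod_cast (by linarith : (0 : ℝ) < t).ne'
  have ht₁ : (t : ℂ) - 1 ≠ 0 := by
    exact_mod_cast (by linarith : (0 : ℝ) < t - 1).ne'
  have hz := exp_mul_I_sq_add_one ψ
  rw [hcos] at hz
  rw [hφψ]
  generalize Complex.exp (ψ * Complex.I) = z at hz ⊢
  push_cast at hz
  field_simp at hz ⊢
  linear_combination -hz
end
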